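/- Fix an integer d ≥ 1 and real numbers s, t with s > t/2 > 0. For all polynomials p and q in d variables with complex coefficients, set u = e^{(t−s)Δ/2}p and v = e^{(t−s)Δ/2}q. Then ∫_{ℂ^d} conj(u_ℂ(z)) · v_ℂ(z) dM_{s,t}(z) = ∫_{ℝ^d} conj((e^{−sΔ/2}p)(x)) · (e^{−sΔ/2}q)(x) dP_s(x), where u_ℂ, v_ℂ denote the evaluations of the polynomials u, v at complex points. (This is identity (3.11): the L²(M_{s,t}) inner product of e^{−A_{s,t}/2}p_ℂ and e^{−A_{s,t}/2}q_ℂ equals the L²(P_s) inner product of e^{−sΔ/2}p and e^{−sΔ/2}q.) -/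

import Mathlib

open MeasureTheory ENNReal

noncomputable section

/-- The Gaussian density `P_s(x) = (2πs)^{-d/2} exp(-|x|²/(2s))` on `ℝ^d`. -/
def gaussDensity (d : ℕ) (s : ℝ) (x : Fin d → ℝ) : ℝ :=
  (2 * Real.pi * s) ^ (-(d : ℝ) / 2) * Real.exp (-(∑ i, x i ^ 2) / (2 * s))

/-- The Gaussian measure `P_s` on `ℝ^d`. -/
def gaussMeasure (d : ℕ) (s : ℝ) : Measure (Fin d → ℝ) :=
  volume.withDensity fun x => ENNReal.ofReal (gaussDensity d s x)

/-- The analytic continuation `P_t(z) = (2πt)^{-d/2} exp(-(z₁² + ⋯ + z_d²)/(2t))` of the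
Gaussian density to `ℂ^d`. -/
def heatKernelC (d : ℕ) (t : ℝ) (z : Fin d → ℂ) : ℂ :=
  (((2 * Real.pi * t) ^ (-(d : ℝ) / 2) : ℝ) : ℂ) * Complex.exp (-(∑ i, z i ^ 2) / (2 * t))

/-- The inclusion of `ℝ^d` into `ℂ^d`. -/
def coeRC (d : ℕ) (x : Fin d → ℝ) : Fin d → ℂ := fun i => (x i : ℂ)

/-- The density of the Gaussian measure `M_{s,t}` on `ℂ^d`:
`M_{s,t}(z) = (πr)^{-d/2} (πt)^{-d/2} exp(-|x|²/r - |y|²/t)` with `r = 2(s - t/2)`,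
where `z = x + iy`. -/
def MDensity (d : ℕ) (s t : ℝ) (z : Fin d → ℂ) : ℝ :=
  (Real.pi * (2 * (s - t / 2))) ^ (-(d : ℝ) / 2) * (Real.pi * t) ^ (-(d : ℝ) / 2) *
    Real.exp (-(∑ i, (z i).re ^ 2) / (2 * (s - t / 2)) - (∑ i, (z i).im ^ 2) / t)

/-- The Gaussian measure `M_{s,t}` on `ℂ^d`. -/
def MMeasure (d : ℕ) (s t : ℝ) : Measure (Fin d → ℂ) :=
  volume.withDensity fun z => ENNReal.ofReal (MDensity d s t z)

/-- The Laplacian `Δ = Σ_j ∂²/∂x_j²` acting on polynomials. -/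
def mvLaplacian (d : ℕ) (p : MvPolynomial (Fin d) ℂ) : MvPolynomial (Fin d) ℂ :=
  ∑ j : Fin d, MvPolynomial.pderiv j (MvPolynomial.pderiv j p)

/-- The heat operator `e^{cΔ/2}` on polynomials, given by the finite sum
`Σ_k (c/2)^k Δ^k p / k!` (which terminates since `Δ^k p = 0` once `2k` exceeds the degree). -/
def heatOp (d : ℕ) (c : ℝ) (p : MvPolynomial (Fin d) ℂ) : MvPolynomial (Fin d) ℂ :=
  ∑ k ∈ Finset.range (p.totalDegree + 1),
    (((c : ℂ) / 2) ^ k / (Nat.factorial k : ℂ)) • (mvLaplacian d)^[k] p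

/-- Evaluation of a complex polynomial at a real point of `ℝ^d`. -/
def evalR (d : ℕ) (p : MvPolynomial (Fin d) ℂ) (x : Fin d → ℝ) : ℂ :=
  MvPolynomial.eval (fun i => (x i : ℂ)) p

theorem mvLaplacian_add (d : ℕ) (p q : MvPolynomial (Fin d) ℂ) :
    mvLaplacian d (p + q) = mvLaplacian d p + mvLaplacian d q := by
  simp [mvLaplacian, Finset.sum_add_distrib]

theorem mvLaplacian_C_mul (d : ℕ) (a : ℂ) (p : MvPolynomial (Fin d) ℂ) :
    mvLaplacian d (MvPolynomial.C a * p) = MvPolynomial.C a * mvLaplacian d p := by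
  simp [mvLaplacian, Finset.mul_sum]

theorem pderiv_comm {σ R : Type*} [CommRing R] (i j : σ) (p : MvPolynomial σ R) :
    MvPolynomial.pderiv i (MvPolynomial.pderiv j p) =
      MvPolynomial.pderiv j (MvPolynomial.pderiv i p) := by
  classical
  have h : ⁅(MvPolynomial.pderiv i : Derivation R (MvPolynomial σ R) (MvPolynomial σ R)),
      (MvPolynomial.pderiv j : Derivation R (MvPolynomial σ R) (MvPolynomial σ R))⁆ = 0 := by
    refine MvPolynomial.derivation_ext fun k => ?_
    simp [Derivation.commutator_apply, MvPolynomial.pderiv_X, Pi.single_apply, apply_ite]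
  have := congrArg (fun D => D p) h
  simpa [Derivation.commutator_apply, sub_eq_zero] using this

theorem pderiv_mvLaplacian (d : ℕ) (i : Fin d) (p : MvPolynomial (Fin d) ℂ) :
    MvPolynomial.pderiv i (mvLaplacian d p) = mvLaplacian d (MvPolynomial.pderiv i p) := by
  simp [mvLaplacian, pderiv_comm i]

theorem pderiv_iterate_mvLaplacian (d : ℕ) (i : Fin d) (k : ℕ) (p : MvPolynomial (Fin d) ℂ) :
    MvPolynomial.pderiv i ((mvLaplacian d)^[k] p) =
      (mvLaplacian d)^[k] (MvPolynomial.pderiv i p) :=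
  (Function.Commute.iterate_right (f := MvPolynomial.pderiv i) (pderiv_mvLaplacian d i) k) p

theorem iterate_mvLaplacian_add (d k : ℕ) (p q : MvPolynomial (Fin d) ℂ) :
    (mvLaplacian d)^[k] (p + q) = (mvLaplacian d)^[k] p + (mvLaplacian d)^[k] q := by
  induction k generalizing p q with
  | zero => rfl
  | succ k ih => simp [mvLaplacian_add, ih]

theorem iterate_mvLaplacian_C_mul (d k : ℕ) (a : ℂ) (p : MvPolynomial (Fin d) ℂ) :
    (mvLaplacian d)^[k] (MvPolynomial.C a * p) = MvPolynomial.C a * (mvLaplacian d)^[k] p := by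
  induction k generalizing p with
  | zero => rfl
  | succ k ih => simp [mvLaplacian_C_mul, ih]

theorem mvLaplacian_X_mul (d : ℕ) (i : Fin d) (p : MvPolynomial (Fin d) ℂ) :
    mvLaplacian d (MvPolynomial.X i * p) =
      MvPolynomial.X i * mvLaplacian d p + MvPolynomial.C 2 * MvPolynomial.pderiv i p := by
  have h (j : Fin d) : MvPolynomial.pderiv j (MvPolynomial.pderiv j (MvPolynomial.X i * p)) =
      MvPolynomial.X i * MvPolynomial.pderiv j (MvPolynomial.pderiv j p) +
        if j = i then MvPolynomial.C 2 * MvPolynomial.pderiv i p else 0 := by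
    split_ifs with hji
    · subst hji
      simp only [Derivation.leibniz, smul_eq_mul, MvPolynomial.pderiv_X_self, map_add,
        mul_one, map_ofNat]
      ring
    · simp [Derivation.leibniz, MvPolynomial.pderiv_X_of_ne (Ne.symm hji)]
  simp only [mvLaplacian, h, Finset.sum_add_distrib, Finset.mul_sum]
  simp

theorem iterate_mvLaplacian_X_mul (d k : ℕ) (i : Fin d) (p : MvPolynomial (Fin d) ℂ) :
    (mvLaplacian d)^[k + 1] (MvPolynomial.X i * p) =
      MvPolynomial.X i * (mvLaplacian d)^[k + 1] p +
        MvPolynomial.C (2 * (k + 1) : ℂ) * (mvLaplacian d)^[k] (MvPolynomial.pderiv i p) := by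
  induction k with
  | zero => simp [mvLaplacian_X_mul]
  | succ k ih =>
    rw [Function.iterate_succ_apply', ih, mvLaplacian_add, mvLaplacian_X_mul, mvLaplacian_C_mul,
      pderiv_iterate_mvLaplacian, ← Function.iterate_succ_apply' (mvLaplacian d),
      ← Function.iterate_succ_apply' (mvLaplacian d)]
    simp only [map_mul, map_add, Nat.cast_succ, map_one]
    ring

theorem iterate_mvLaplacian_eq_zero (d n : ℕ) (p : MvPolynomial (Fin d) ℂ)
    (hp : ∀ m : Fin d →₀ ℕ, n ≤ m.degree → p.coeff m = 0) : (mvLaplacian d)^[n] p = 0 := by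
  induction n generalizing p with
  | zero =>
    ext m
    simpa using hp m (Nat.zero_le _)
  | succ n ih =>
    rw [Function.iterate_succ_apply]
    refine ih _ fun m hm => ?_
    rw [mvLaplacian, MvPolynomial.coeff_sum]
    refine Finset.sum_eq_zero fun i _ => ?_
    rw [MvPolynomial.coeff_pderiv, MvPolynomial.coeff_pderiv, hp _ (by simp; omega), zero_mul,
      zero_mul]

theorem heatOp_eq_sum (d : ℕ) (c : ℝ) (p : MvPolynomial (Fin d) ℂ) (N : ℕ)
    (hN : p.totalDegree + 1 ≤ N) :
    heatOp d c p = ∑ k ∈ Finset.range N,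
      (((c : ℂ) / 2) ^ k / (Nat.factorial k : ℂ)) • (mvLaplacian d)^[k] p := by
  refine Finset.sum_subset (Finset.range_mono hN) fun k _ hk => ?_
  rw [iterate_mvLaplacian_eq_zero, smul_zero]
  intro m hm
  refine MvPolynomial.coeff_eq_zero_of_totalDegree_lt ?_
  simp only [Finset.mem_range, not_lt] at hk
  change p.totalDegree < m.degree
  omega

theorem heatOp_add (d : ℕ) (c : ℝ) (p q : MvPolynomial (Fin d) ℂ) :
    heatOp d c (p + q) = heatOp d c p + heatOp d c q := by
  set N := max (p + q).totalDegree (max p.totalDegree q.totalDegree) + 1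
  rw [heatOp_eq_sum d c (p + q) N (by omega), heatOp_eq_sum d c p N (by omega),
    heatOp_eq_sum d c q N (by omega), ← Finset.sum_add_distrib]
  simp [iterate_mvLaplacian_add]

theorem heatOp_C_mul (d : ℕ) (c : ℝ) (a : ℂ) (p : MvPolynomial (Fin d) ℂ) :
    heatOp d c (MvPolynomial.C a * p) = MvPolynomial.C a * heatOp d c p := by
  set N := max (MvPolynomial.C a * p).totalDegree p.totalDegree + 1
  rw [heatOp_eq_sum d c (MvPolynomial.C a * p) N (by omega), heatOp_eq_sum d c p N (by omega)]
  simp [iterate_mvLaplacian_C_mul, Finset.mul_sum]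

theorem pderiv_heatOp (d : ℕ) (c : ℝ) (i : Fin d) (p : MvPolynomial (Fin d) ℂ) :
    MvPolynomial.pderiv i (heatOp d c p) = heatOp d c (MvPolynomial.pderiv i p) := by
  set N := max (MvPolynomial.pderiv i p).totalDegree p.totalDegree + 1
  rw [heatOp_eq_sum d c (MvPolynomial.pderiv i p) N (by omega), heatOp_eq_sum d c p N (by omega)]
  simp [pderiv_iterate_mvLaplacian]

theorem heatOp_X_mul (d : ℕ) (c : ℝ) (i : Fin d) (p : MvPolynomial (Fin d) ℂ) :
    heatOp d c (MvPolynomial.X i * p) =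
      MvPolynomial.X i * heatOp d c p +
        MvPolynomial.C (c : ℂ) * heatOp d c (MvPolynomial.pderiv i p) := by
  set N := max (MvPolynomial.X i * p).totalDegree
    (max p.totalDegree (MvPolynomial.pderiv i p).totalDegree) + 1
  rw [heatOp_eq_sum d c (MvPolynomial.X i * p) (N + 1) (by omega),
    heatOp_eq_sum d c p (N + 1) (by omega),
    heatOp_eq_sum d c (MvPolynomial.pderiv i p) N (by omega),
    Finset.sum_range_succ', Finset.sum_range_succ' _ N]
  simp only [iterate_mvLaplacian_X_mul, smul_add, Finset.sum_add_distrib, mul_add, Finset.mul_sum,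
    mul_smul_comm, Function.iterate_zero, id]
  rw [add_right_comm]
  congr 1
  refine Finset.sum_congr rfl fun k _ => ?_
  rw [← MvPolynomial.smul_eq_C_mul, ← MvPolynomial.smul_eq_C_mul, smul_smul, smul_smul]
  congr 1
  have h1 : (k + 1 : ℂ) ≠ 0 := by exact_mod_cast k.succ_ne_zero
  have h2 : (Nat.factorial k : ℂ) ≠ 0 := by exact_mod_cast k.factorial_ne_zero
  rw [Nat.factorial_succ, pow_succ]
  push_cast
  field_simp

theorem heatOp_one (d : ℕ) (c : ℝ) : heatOp d c 1 = 1 := by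
  simp [heatOp]

/-- A Hermitian form on polynomials, conjugate linear in the first variable and normalized at `1`,
for which the adjoint of multiplication by `X i` is `s ∂ᵢ` up to the correction `-c ∂ᵢ`. -/
structure IsGaussianForm (d : ℕ) (s c : ℝ)
    (G : MvPolynomial (Fin d) ℂ → MvPolynomial (Fin d) ℂ → ℂ) : Prop where
  conj_symm : ∀ p q, (starRingEnd ℂ) (G p q) = G q p
  add_left : ∀ p p' q, G (p + p') q = G p q + G p' q
  C_mul_left : ∀ a p q, G (MvPolynomial.C a * p) q = (starRingEnd ℂ) a * G p q
  X_mul_left : ∀ i p q, G (MvPolynomial.X i * p) q =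
    -(c : ℂ) * G (MvPolynomial.pderiv i p) q + (s : ℂ) * G p (MvPolynomial.pderiv i q)
  one_one : G 1 1 = 1

namespace IsGaussianForm

variable {d : ℕ} {s c : ℝ} {G G' : MvPolynomial (Fin d) ℂ → MvPolynomial (Fin d) ℂ → ℂ}

theorem comp_heatOp (h : IsGaussianForm d s c G) :
    IsGaussianForm d s 0 fun p q => G (heatOp d c p) (heatOp d c q) where
  conj_symm _ _ := h.conj_symm _ _
  add_left p p' q := by rw [heatOp_add, h.add_left]
  C_mul_left a p q := by rw [heatOp_C_mul, h.C_mul_left]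
  X_mul_left i p q := by
    rw [heatOp_X_mul, h.add_left, h.X_mul_left, h.C_mul_left, pderiv_heatOp, pderiv_heatOp]
    simp
  one_one := by rw [heatOp_one, h.one_one]

theorem zero_left (h : IsGaussianForm d s c G) (q : MvPolynomial (Fin d) ℂ) : G 0 q = 0 := by
  simpa using h.C_mul_left 0 0 q

theorem zero_right (h : IsGaussianForm d s c G) (p : MvPolynomial (Fin d) ℂ) : G p 0 = 0 := by
  rw [← h.conj_symm, h.zero_left, map_zero]

theorem one_left_eq (h : IsGaussianForm d s 0 G) (h' : IsGaussianForm d s 0 G')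
    (q : MvPolynomial (Fin d) ℂ) : G 1 q = G' 1 q := by
  rw [← h.conj_symm, ← h'.conj_symm]
  congr 1
  induction q using MvPolynomial.induction_on with
  | C a =>
    rw [← mul_one (MvPolynomial.C a), h.C_mul_left, h'.C_mul_left, h.one_one, h'.one_one]
  | add p q hp hq => rw [h.add_left, h'.add_left, hp, hq]
  | mul_X p i _ =>
    rw [mul_comm, h.X_mul_left, h'.X_mul_left]
    simp [h.zero_right, h'.zero_right]

theorem unique (h : IsGaussianForm d s 0 G) (h' : IsGaussianForm d s 0 G')
    (p q : MvPolynomial (Fin d) ℂ) : G p q = G' p q := by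
  induction p using MvPolynomial.induction_on generalizing q with
  | C a =>
    rw [← mul_one (MvPolynomial.C a), h.C_mul_left, h'.C_mul_left, h.one_left_eq h']
  | add p p' hp hp' => rw [h.add_left, h'.add_left, hp, hp']
  | mul_X p i hp => rw [mul_comm, h.X_mul_left, h'.X_mul_left, hp]; simp

end IsGaussianForm

section GaussianIntegral

variable {d : ℕ} {E : Type*} [NormedAddCommGroup E]

/-- Continuous functions on `E^d` that grow slower than every Gaussian. -/
def HasSubGaussianGrowth (F : (Fin d → E) → ℂ) : Prop :=
  Continuous F ∧ ∀ ε > 0, ∃ C : ℝ, ∀ z, ‖F z‖ ≤ C * Real.exp (ε * ∑ i, ‖z i‖ ^ 2)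

namespace HasSubGaussianGrowth

variable {F G : (Fin d → E) → ℂ}

theorem const (a : ℂ) : HasSubGaussianGrowth fun _ : Fin d → E => a := by
  refine ⟨continuous_const, fun ε hε => ⟨‖a‖, fun z => ?_⟩⟩
  refine le_mul_of_one_le_right (norm_nonneg _) (Real.one_le_exp ?_)
  positivity

theorem add (hF : HasSubGaussianGrowth F) (hG : HasSubGaussianGrowth G) :
    HasSubGaussianGrowth fun z => F z + G z := by
  refine ⟨hF.1.add hG.1, fun ε hε => ?_⟩
  obtain ⟨C, hC⟩ := hF.2 ε hε
  obtain ⟨D, hD⟩ := hG.2 ε hε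
  refine ⟨C + D, fun z => (norm_add_le _ _).trans ?_⟩
  rw [add_mul]
  exact add_le_add (hC z) (hD z)

theorem mul (hF : HasSubGaussianGrowth F) (hG : HasSubGaussianGrowth G) :
    HasSubGaussianGrowth fun z => F z * G z := by
  refine ⟨hF.1.mul hG.1, fun ε hε => ?_⟩
  obtain ⟨C, hC⟩ := hF.2 (ε / 2) (half_pos hε)
  obtain ⟨D, hD⟩ := hG.2 (ε / 2) (half_pos hε)
  refine ⟨C * D, fun z => ?_⟩
  rw [norm_mul]
  refine (mul_le_mul (hC z) (hD z) (norm_nonneg _) ((norm_nonneg _).trans (hC z))).trans_eq ?_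
  rw [mul_mul_mul_comm, ← Real.exp_add]
  ring_nf

theorem conj (hF : HasSubGaussianGrowth F) :
    HasSubGaussianGrowth fun z => (starRingEnd ℂ) (F z) :=
  ⟨Complex.continuous_conj.comp hF.1, by simpa using hF.2⟩

variable [NormedSpace ℝ E]

theorem coord (φ : E →L[ℝ] ℂ) (i : Fin d) : HasSubGaussianGrowth fun z : Fin d → E => φ (z i) := by
  refine ⟨by fun_prop, fun ε hε => ⟨‖φ‖ * (1 + 1 / ε), fun z => ?_⟩⟩
  rw [mul_assoc]
  refine (φ.le_opNorm _).trans (mul_le_mul_of_nonneg_left ?_ (norm_nonneg _))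
  have h1 : ‖z i‖ ^ 2 ≤ ∑ i, ‖z i‖ ^ 2 :=
    Finset.single_le_sum (f := fun i => ‖z i‖ ^ 2) (fun i _ => sq_nonneg _) (Finset.mem_univ i)
  have h2 := Real.add_one_le_exp (ε * ∑ i, ‖z i‖ ^ 2)
  calc ‖z i‖ ≤ 1 + ‖z i‖ ^ 2 := by nlinarith [sq_nonneg (‖z i‖ - 1)]
    _ ≤ (1 + 1 / ε) * (ε * ‖z i‖ ^ 2 + 1) := by
      have : (1 + 1 / ε) * (ε * ‖z i‖ ^ 2 + 1) =
          1 + ‖z i‖ ^ 2 + (ε * ‖z i‖ ^ 2 + 1 / ε) := by field_simp; ring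
      rw [this]
      have : 0 ≤ ε * ‖z i‖ ^ 2 + 1 / ε := by positivity
      linarith
    _ ≤ (1 + 1 / ε) * Real.exp (ε * ∑ i, ‖z i‖ ^ 2) := by
      gcongr
      exact (by gcongr : ε * ‖z i‖ ^ 2 + 1 ≤ _).trans h2

theorem eval (φ : E →L[ℝ] ℂ) (p : MvPolynomial (Fin d) ℂ) :
    HasSubGaussianGrowth fun z : Fin d → E => MvPolynomial.eval (fun i => φ (z i)) p := by
  induction p using MvPolynomial.induction_on with
  | C a => simpa using const a
  | add p q hp hq => simpa using hp.add hq
  | mul_X p i hp => simpa using hp.mul (coord φ i)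

end HasSubGaussianGrowth

variable [NormedSpace ℝ E]

theorem hasDerivAt_eval_line (φ : E →L[ℝ] ℂ) (i : Fin d) (v : E) (z : Fin d → E)
    (p : MvPolynomial (Fin d) ℂ) :
    HasDerivAt
      (fun τ : ℝ => MvPolynomial.eval (fun j => φ ((z + τ • (Pi.single i v : Fin d → E)) j)) p)
      (φ v * MvPolynomial.eval (fun j => φ (z j)) (MvPolynomial.pderiv i p)) 0 := by
  induction p using MvPolynomial.induction_on with
  | C a => simpa using hasDerivAt_const (0 : ℝ) a
  | add p q hp hq => simpa [mul_add] using hp.fun_add hq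
  | mul_X p j hp =>
    have hX : HasDerivAt (fun τ : ℝ => φ ((z + τ • (Pi.single i v : Fin d → E)) j))
        (φ ((Pi.single i v : Fin d → E) j)) 0 := by
      have := ((hasDerivAt_id (0 : ℝ)).smul_const
        (φ ((Pi.single i v : Fin d → E) j))).const_add (φ (z j))
      simpa using this
    simp only [map_mul, MvPolynomial.eval_X]
    refine (hp.fun_mul hX).congr_deriv ?_
    rcases eq_or_ne j i with rfl | hji
    · simp [Derivation.leibniz]
      ring
    · simp [Derivation.leibniz, MvPolynomial.pderiv_X_of_ne hji, Pi.single_eq_of_ne hji]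
      ring

variable [MeasureSpace E]

/-- The sesquilinear form `∫ conj(p(φ z)) q(φ z) K exp(-∑ Q(zᵢ)) dz` on polynomials. -/
def gaussForm (φ : E →L[ℝ] ℂ) (K : ℝ) (Q : E → ℝ) (p q : MvPolynomial (Fin d) ℂ) : ℂ :=
  ∫ z : Fin d → E, (starRingEnd ℂ) (MvPolynomial.eval (fun i => φ (z i)) p) *
    MvPolynomial.eval (fun i => φ (z i)) q * ((K * Real.exp (-∑ i, Q (z i)) : ℝ) : ℂ)

variable [FiniteDimensional ℝ E] [BorelSpace E] [(volume : Measure E).IsAddHaarMeasure]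

theorem HasSubGaussianGrowth.integrable {F : (Fin d → E) → ℂ} (hF : HasSubGaussianGrowth F)
    {Q : E → ℝ} (hQ : Continuous Q) {κ : ℝ} (hκ : 0 < κ) (hQκ : ∀ x, κ * ‖x‖ ^ 2 ≤ Q x)
    (hE : ∀ ε > 0, Integrable fun x : E => Real.exp (-ε * ‖x‖ ^ 2)) (K : ℝ) :
    Integrable fun z : Fin d → E => F z * ((K * Real.exp (-∑ i, Q (z i)) : ℝ) : ℂ) := by
  obtain ⟨C, hC⟩ := hF.2 (κ / 2) (half_pos hκ)
  have hint : Integrable fun z : Fin d → E => ∏ i, Real.exp (-(κ / 2) * ‖z i‖ ^ 2) :=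
    Integrable.fintype_prod fun _ => hE (κ / 2) (half_pos hκ)
  have hFc := hF.1
  refine (hint.const_mul (C * |K|)).mono' (by fun_prop) (.of_forall fun z => ?_)
  have h1 : ∑ i, κ * ‖z i‖ ^ 2 ≤ ∑ i, Q (z i) := Finset.sum_le_sum fun i _ => hQκ (z i)
  rw [← Finset.mul_sum] at h1
  rw [norm_mul, Complex.norm_real, norm_mul, Real.norm_eq_abs, Real.norm_eq_abs, Real.abs_exp,
    ← Real.exp_sum, ← Finset.mul_sum]
  calc ‖F z‖ * (|K| * Real.exp (-∑ i, Q (z i)))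
      ≤ C * Real.exp (κ / 2 * ∑ i, ‖z i‖ ^ 2) * (|K| * Real.exp (-(κ * ∑ i, ‖z i‖ ^ 2))) := by
        gcongr
        · exact (norm_nonneg _).trans (hC z)
        · exact hC z
    _ = C * |K| * Real.exp (-(κ / 2) * ∑ i, ‖z i‖ ^ 2) := by
        rw [mul_mul_mul_comm, ← Real.exp_add]
        ring_nf

theorem integral_lineDeriv_mul_gaussian {F F' : (Fin d → E) → ℂ} (hF : HasSubGaussianGrowth F)
    (hF' : HasSubGaussianGrowth F') {i : Fin d} {v : E}
    (hFF' : ∀ z, HasLineDerivAt ℝ F (F' z) z (Pi.single i v))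
    {Q : E → ℝ} (hQ : Continuous Q) {κ : ℝ} (hκ : 0 < κ) (hQκ : ∀ x, κ * ‖x‖ ^ 2 ≤ Q x)
    (hE : ∀ ε > 0, Integrable fun x : E => Real.exp (-ε * ‖x‖ ^ 2)) (K : ℝ)
    (l : E →L[ℝ] ℝ) (hl : ∀ x, HasDerivAt (fun τ : ℝ => Q (x + τ • v)) (l x) 0) :
    ∫ z, (l (z i) : ℂ) * F z * ((K * Real.exp (-∑ i, Q (z i)) : ℝ) : ℂ) =
      ∫ z, F' z * ((K * Real.exp (-∑ i, Q (z i)) : ℝ) : ℂ) := by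
  have hlF : HasSubGaussianGrowth fun z => (l (z i) : ℂ) * F z :=
    (HasSubGaussianGrowth.coord (Complex.ofRealCLM.comp l) i).mul hF
  have hw (z : Fin d → E) : HasLineDerivAt ℝ
      (fun z : Fin d → E => ((K * Real.exp (-∑ i, Q (z i)) : ℝ) : ℂ))
      (-(l (z i) : ℂ) * ((K * Real.exp (-∑ i, Q (z i)) : ℝ) : ℂ)) z (Pi.single i v) := by
    have hsum : HasDerivAt
        (fun τ : ℝ => ∑ j, Q ((z + τ • (Pi.single i v : Fin d → E)) j)) (l (z i)) 0 := by
      have h := HasDerivAt.fun_sum (u := Finset.univ) (x := (0 : ℝ))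
        (A := fun j (τ : ℝ) => Q ((z + τ • (Pi.single i v : Fin d → E)) j))
        (A' := fun j => if j = i then l (z i) else 0) fun j _ => by
          rcases eq_or_ne j i with rfl | hji
          · simpa using hl (z j)
          · simpa [Pi.single_eq_of_ne hji, hji] using hasDerivAt_const (0 : ℝ) (Q (z j))
      simpa using h
    have h := ((hsum.fun_neg.exp).const_mul K).ofReal_comp
    refine h.congr_deriv ?_
    simp
    ring
  have key := integral_bilinear_hasLineDerivAt_right_eq_neg_left_of_integrable
    (μ := (volume : Measure (Fin d → E))) (f := F) (f' := F')
    (g := fun z : Fin d → E => ((K * Real.exp (-∑ i, Q (z i)) : ℝ) : ℂ))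
    (g' := fun z => -(l (z i) : ℂ) * ((K * Real.exp (-∑ i, Q (z i)) : ℝ) : ℂ))
    (v := Pi.single i v) (B := ContinuousLinearMap.mul ℝ ℂ)
    (hF'.integrable hQ hκ hQκ hE K)
    (by
      refine (hlF.integrable hQ hκ hQκ hE K).neg.congr (.of_forall fun z => ?_)
      simp only [Pi.neg_apply, ContinuousLinearMap.mul_apply']
      ring)
    (hF.integrable hQ hκ hQκ hE K) (fun z _ => hFF' z) (fun z _ => hw z)
  simp only [ContinuousLinearMap.mul_apply'] at key
  rw [← neg_inj, ← key, ← integral_neg]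
  refine integral_congr_ae (.of_forall fun z => ?_)
  ring

theorem isGaussianForm_gaussForm {φ : E →L[ℝ] ℂ} {K : ℝ} {Q : E → ℝ} (hQ : Continuous Q)
    {κ : ℝ} (hκ : 0 < κ) (hQκ : ∀ x, κ * ‖x‖ ^ 2 ≤ Q x)
    (hE : ∀ ε > 0, Integrable fun x : E => Real.exp (-ε * ‖x‖ ^ 2))
    (hK : K * (∫ x, Real.exp (-Q x)) ^ d = 1) {s c : ℝ} {ι : Type*} [Fintype ι]
    (l : ι → E →L[ℝ] ℝ) (v : ι → E) (α : ι → ℂ)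
    (hl : ∀ a x, HasDerivAt (fun τ : ℝ => Q (x + τ • v a)) (l a x) 0)
    (hφ : ∀ x, (starRingEnd ℂ) (φ x) = ∑ a, α a * l a x)
    (hc : ∑ a, α a * (starRingEnd ℂ) (φ (v a)) = -c) (hs : ∑ a, α a * φ (v a) = s) :
    IsGaussianForm d s c (gaussForm φ K Q) where
  conj_symm p q := by
    rw [gaussForm, gaussForm, ← integral_conj]
    refine integral_congr_ae (.of_forall fun z => ?_)
    simp only [map_mul, Complex.conj_conj, Complex.conj_ofReal]
    ring
  add_left p p' q := by
    have h (p : MvPolynomial (Fin d) ℂ) :=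
      ((HasSubGaussianGrowth.eval φ p).conj.mul (.eval φ q)).integrable hQ hκ hQκ hE K
    rw [gaussForm, gaussForm, gaussForm, ← integral_add (h p) (h p')]
    refine integral_congr_ae (.of_forall fun z => ?_)
    simp only [map_add]
    ring
  C_mul_left a p q := by
    rw [gaussForm, gaussForm, ← integral_const_mul]
    refine integral_congr_ae (.of_forall fun z => ?_)
    simp only [map_mul, MvPolynomial.eval_C]
    ring
  X_mul_left i p q := by
    have hg (p q : MvPolynomial (Fin d) ℂ) :=
      (HasSubGaussianGrowth.eval φ p).conj.mul (.eval φ q)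
    have stein (a : ι) := integral_lineDeriv_mul_gaussian (F' := fun z =>
        (starRingEnd ℂ) (φ (v a)) *
          ((starRingEnd ℂ) (MvPolynomial.eval (fun i => φ (z i)) (MvPolynomial.pderiv i p)) *
            MvPolynomial.eval (fun i => φ (z i)) q) +
        φ (v a) * ((starRingEnd ℂ) (MvPolynomial.eval (fun i => φ (z i)) p) *
            MvPolynomial.eval (fun i => φ (z i)) (MvPolynomial.pderiv i q)))
      (hg p q) (((HasSubGaussianGrowth.const _).mul (hg _ _)).add
        ((HasSubGaussianGrowth.const _).mul (hg _ _))) (i := i) (v := v a)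
      (fun z => by
        have h := (hasDerivAt_eval_line φ i (v a) z p).star.mul
          (hasDerivAt_eval_line φ i (v a) z q)
        refine h.congr_deriv ?_
        simp
        ring) hQ hκ hQκ hE K (l a) (hl a)
    have hint (p q : MvPolynomial (Fin d) ℂ) := (hg p q).integrable hQ hκ hQκ hE K
    have hl_int (a : ι) : Integrable fun z : Fin d → E => (l a (z i) : ℂ) *
          ((starRingEnd ℂ) (MvPolynomial.eval (fun i => φ (z i)) p) *
            MvPolynomial.eval (fun i => φ (z i)) q) *
            ((K * Real.exp (-∑ i, Q (z i)) : ℝ) : ℂ) :=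
      ((HasSubGaussianGrowth.coord (Complex.ofRealCLM.comp (l a)) i).mul
      (hg p q)).integrable hQ hκ hQκ hE K
    have hdir (a : ι) : ∫ z : Fin d → E, (l a (z i) : ℂ) *
          ((starRingEnd ℂ) (MvPolynomial.eval (fun i => φ (z i)) p) *
            MvPolynomial.eval (fun i => φ (z i)) q) *
            ((K * Real.exp (-∑ i, Q (z i)) : ℝ) : ℂ) =
        (starRingEnd ℂ) (φ (v a)) * gaussForm φ K Q (MvPolynomial.pderiv i p) q +
          φ (v a) * gaussForm φ K Q p (MvPolynomial.pderiv i q) := by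
      rw [stein, gaussForm, gaussForm, ← integral_const_mul, ← integral_const_mul,
        ← integral_add ((hint _ _).const_mul _) ((hint _ _).const_mul _)]
      refine integral_congr_ae (.of_forall fun z => ?_)
      ring
    calc gaussForm φ K Q (MvPolynomial.X i * p) q
        = ∫ z : Fin d → E, ∑ a, α a * ((l a (z i) : ℂ) *
            ((starRingEnd ℂ) (MvPolynomial.eval (fun i => φ (z i)) p) *
            MvPolynomial.eval (fun i => φ (z i)) q) *
            ((K * Real.exp (-∑ i, Q (z i)) : ℝ) : ℂ)) := by
          refine integral_congr_ae (.of_forall fun z => ?_)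
          simp only [map_mul, MvPolynomial.eval_X, hφ, Finset.sum_mul]
          refine Finset.sum_congr rfl fun a _ => ?_
          ring
      _ = _ := by
          rw [integral_finsetSum _ fun a _ => (hl_int a).const_mul (α a)]
          simp only [integral_const_mul, hdir]
          simp only [mul_add, ← mul_assoc, Finset.sum_add_distrib, ← Finset.sum_mul, hc, hs]
  one_one := by
    have h : ∫ z : Fin d → E, K * Real.exp (-∑ i, Q (z i)) = 1 := by
      simp only [integral_const_mul, ← Finset.sum_neg_distrib, Real.exp_sum]
      rw [integral_fintype_prod_volume_eq_pow fun x : E => Real.exp (-Q x), Fintype.card_fin, hK]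
    simp only [gaussForm, map_one, one_mul]
    rw [integral_complex_ofReal, h, Complex.ofReal_one]

end GaussianIntegral

theorem rpow_neg_half_mul_sqrt_pow {a : ℝ} (ha : 0 < a) (d : ℕ) :
    a ^ (-(d : ℝ) / 2) * √a ^ d = 1 := by
  rw [Real.sqrt_eq_rpow, ← Real.rpow_natCast, ← Real.rpow_mul ha.le, ← Real.rpow_add ha]
  ring_nf
  exact Real.rpow_zero a

theorem integral_complex_gaussian {a b : ℝ} :
    ∫ z : ℂ, Real.exp (-(a * z.re ^ 2 + b * z.im ^ 2)) = √(Real.pi / a) * √(Real.pi / b) := by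
  rw [← integral_gaussian a, ← integral_gaussian b, ← integral_prod_mul,
    ← Measure.volume_eq_prod,
    ← Complex.volume_preserving_equiv_real_prod.integral_comp
      Complex.measurableEquivRealProd.measurableEmbedding]
  refine integral_congr_ae (.of_forall fun z => ?_)
  simp only [Complex.measurableEquivRealProd_apply, ← Real.exp_add]
  ring_nf

theorem integrable_exp_neg_mul_sq_norm_complex {ε : ℝ} (hε : 0 < ε) :
    Integrable fun z : ℂ => Real.exp (-ε * ‖z‖ ^ 2) := by
  have h := (integrable_exp_neg_mul_sq hε).mul_prod (integrable_exp_neg_mul_sq hε)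
  rw [← Measure.volume_eq_prod,
    ← Complex.volume_preserving_equiv_real_prod.integrable_comp_emb
      Complex.measurableEquivRealProd.measurableEmbedding] at h
  refine h.congr (.of_forall fun z => ?_)
  simp only [Function.comp_apply, Complex.measurableEquivRealProd_apply, ← Real.exp_add,
    Complex.sq_norm, Complex.normSq_apply]
  ring_nf

theorem integral_withDensity_ofReal {X : Type*} [MeasurableSpace X] {μ : Measure X} {ρ : X → ℝ}
    (hρ : Measurable ρ) (hρ0 : ∀ x, 0 ≤ ρ x) (F : X → ℂ) :
    ∫ x, F x ∂(μ.withDensity fun x => ENNReal.ofReal (ρ x)) = ∫ x, F x * (ρ x : ℂ) ∂μ := by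
  rw [integral_withDensity_eq_integral_toReal_smul hρ.ennreal_ofReal
    (.of_forall fun _ => ENNReal.ofReal_lt_top)]
  refine integral_congr_ae (.of_forall fun x => ?_)
  simp [ENNReal.toReal_ofReal (hρ0 x), mul_comm]

theorem integral_gaussMeasure (d : ℕ) {s : ℝ} (hs : 0 < s) (p q : MvPolynomial (Fin d) ℂ) :
    ∫ x : Fin d → ℝ, (starRingEnd ℂ) (evalR d p x) * evalR d q x ∂(gaussMeasure d s) =
      gaussForm Complex.ofRealCLM ((2 * Real.pi * s) ^ (-(d : ℝ) / 2))
        (fun x => 1 / (2 * s) * x ^ 2) p q := by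
  rw [gaussMeasure, integral_withDensity_ofReal (by unfold gaussDensity; fun_prop)
    fun x => by unfold gaussDensity; positivity]
  refine integral_congr_ae (.of_forall fun x => ?_)
  simp only [evalR, gaussDensity, Complex.ofRealCLM_apply, ← Finset.mul_sum]
  ring_nf

theorem integral_MMeasure (d : ℕ) {s t : ℝ} (ht : 0 < t) (hst : 0 < s - t / 2)
    (p q : MvPolynomial (Fin d) ℂ) :
    ∫ z : Fin d → ℂ, (starRingEnd ℂ) (MvPolynomial.eval z p) * MvPolynomial.eval z q
        ∂(MMeasure d s t) =
      gaussForm (ContinuousLinearMap.id ℝ ℂ)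
        ((Real.pi * (2 * (s - t / 2))) ^ (-(d : ℝ) / 2) * (Real.pi * t) ^ (-(d : ℝ) / 2))
        (fun z => 1 / (2 * (s - t / 2)) * z.re ^ 2 + 1 / t * z.im ^ 2) p q := by
  rw [MMeasure, integral_withDensity_ofReal (by unfold MDensity; fun_prop)
    fun x => by unfold MDensity; positivity]
  refine integral_congr_ae (.of_forall fun z => ?_)
  simp only [MDensity, ContinuousLinearMap.id_apply, Finset.sum_add_distrib, ← Finset.mul_sum]
  congr 4
  ring

theorem isGaussianForm_gaussMeasure (d : ℕ) {s : ℝ} (hs : 0 < s) :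
    IsGaussianForm d s (-s) (gaussForm Complex.ofRealCLM ((2 * Real.pi * s) ^ (-(d : ℝ) / 2))
      (fun x => 1 / (2 * s) * x ^ 2)) := by
  refine isGaussianForm_gaussForm (ι := Fin 1) (κ := 1 / (2 * s)) (by fun_prop) (by positivity)
    (fun x => by simp) (fun ε hε => by simpa using integrable_exp_neg_mul_sq hε) ?_
    (fun _ => (1 / s) • ContinuousLinearMap.id ℝ ℝ) (fun _ => 1) (fun _ => s)
    (fun _ x => ?_) (fun x => ?_) (by simp) (by simp)
  · simp_rw [← neg_mul]
    rw [integral_gaussian, show Real.pi / (1 / (2 * s)) = 2 * Real.pi * s by field_simp]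
    exact rpow_neg_half_mul_sqrt_pow (by positivity) d
  · have h := ((((hasDerivAt_id (0 : ℝ)).smul_const (1 : ℝ)).const_add x).pow 2).const_mul
      (1 / (2 * s))
    refine h.congr_deriv ?_
    simp
    field_simp
  · have : (s : ℂ) ≠ 0 := by exact_mod_cast hs.ne'
    simp
    field_simp

theorem isGaussianForm_MMeasure (d : ℕ) {s t : ℝ} (ht : 0 < t) (hst : 0 < s - t / 2) :
    IsGaussianForm d s (t - s) (gaussForm (ContinuousLinearMap.id ℝ ℂ)
        ((Real.pi * (2 * (s - t / 2))) ^ (-(d : ℝ) / 2) * (Real.pi * t) ^ (-(d : ℝ) / 2))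
        (fun z => 1 / (2 * (s - t / 2)) * z.re ^ 2 + 1 / t * z.im ^ 2)) := by
  have hr : 0 < 2 * (s - t / 2) := by linarith
  set r := 2 * (s - t / 2) with hr_def
  have hrs : (r : ℂ) = 2 * (s - t / 2) := by rw [hr_def]; push_cast; ring
  refine isGaussianForm_gaussForm (ι := Fin 2) (κ := min (1 / r) (1 / t)) (by fun_prop)
    (by positivity) (fun z => ?_) (fun ε hε => integrable_exp_neg_mul_sq_norm_complex hε) ?_
    ![(2 / r) • Complex.reCLM, (2 / t) • Complex.imCLM] ![1, Complex.I]
    ![(r / 2 : ℂ), -(t / 2) * Complex.I] ?_ (fun z => ?_) ?_ ?_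
  · rw [Complex.sq_norm, Complex.normSq_apply, mul_add, ← sq, ← sq]
    gcongr
    · exact min_le_left _ _
    · exact min_le_right _ _
  · rw [integral_complex_gaussian, mul_pow, mul_mul_mul_comm,
      show Real.pi / (1 / r) = Real.pi * r by field_simp,
      show Real.pi / (1 / t) = Real.pi * t by field_simp,
      rpow_neg_half_mul_sqrt_pow (by positivity), rpow_neg_half_mul_sqrt_pow (by positivity),
      mul_one]
  · rw [Fin.forall_fin_two]
    constructor <;> intro z
    · have h := (((((hasDerivAt_id (0 : ℝ)).const_add z.re).pow 2).const_mul (1 / r)).add_const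
        (1 / t * z.im ^ 2))
      refine (h.congr_of_eventuallyEq (.of_forall fun τ => ?_)).congr_deriv ?_
      · simp
      · simp
        ring
    · have h := (((((hasDerivAt_id (0 : ℝ)).const_add z.im).pow 2).const_mul (1 / t)).const_add
        (1 / r * z.re ^ 2))
      refine (h.congr_of_eventuallyEq (.of_forall fun τ => ?_)).congr_deriv ?_
      · simp
      · simp
        ring
  · simp only [ContinuousLinearMap.id_apply, Fin.sum_univ_two]
    apply Complex.ext <;> simp <;> field_simp
  · simp only [ContinuousLinearMap.id_apply, Fin.sum_univ_two]
    simp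
    rw [hrs]
    ring_nf
    simp
    ring
  · simp only [ContinuousLinearMap.id_apply, Fin.sum_univ_two]
    simp
    rw [hrs]
    ring_nf
    simp

/-- identity (3.11). For `s > t/2 > 0` and polynomials `p, q`, with
`u = e^{(t-s)Δ/2}p` and `v = e^{(t-s)Δ/2}q`, the `L²(M_{s,t})` inner product of the
analytic continuations `u_ℂ, v_ℂ` equals the `L²(P_s)` inner product of `e^{-sΔ/2}p` and
`e^{-sΔ/2}q`. -/
theorem complex_real_inner_products_agree
    (d : ℕ) (hd : 1 ≤ d) (s t : ℝ) (ht : 0 < t / 2) (hst : t / 2 < s)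
    (p q : MvPolynomial (Fin d) ℂ) :
    ∫ z : Fin d → ℂ,
        (starRingEnd ℂ) (MvPolynomial.eval z (heatOp d (t - s) p)) *
          MvPolynomial.eval z (heatOp d (t - s) q) ∂(MMeasure d s t)
      = ∫ x : Fin d → ℝ,
          (starRingEnd ℂ) (evalR d (heatOp d (-s) p) x) * evalR d (heatOp d (-s) q) x
            ∂(gaussMeasure d s) := by
  have ht' : 0 < t := by linarith
  have hst' : 0 < s - t / 2 := by linarith
  have hs : 0 < s := by linarith
  rw [integral_MMeasure d ht' hst', integral_gaussMeasure d hs]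
  exact (isGaussianForm_MMeasure d ht' hst').comp_heatOp.unique
    (isGaussianForm_gaussMeasure d hs).comp_heatOp p q
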